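/- arXiv:1901.10269 — 4 statements merged into one kernel-verified Lean document; each statement's English description precedes it below -/
import Mathlib

section
/- (Comparison of hill-climbing constants) c_{M₁} ≥ c_{M₂}. Moreover, if U is injective (U has no repeated values), then c_{M₁} > c_{M₂}. -/
open Finset Filter MeasureTheory

noncomputable def gibbs {X : Type*} [Fintype X] (p U : X → ℝ) (T : ℝ) (x : X) : ℝ :=
  Real.exp (-U x / T) * p x / ∑ y, Real.exp (-U y / T) * p y

noncomputable def M1 {X : Type*} [Fintype X] [DecidableEq X] (Q : X → X → ℝ) (U : X → ℝ)
    (T : ℝ) (x y : X) : ℝ :=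
  if x = y then -∑ z ∈ Finset.univ.erase x, Q x z * Real.exp (-(max (U z - U x) 0) / T)
  else Q x y * Real.exp (-(max (U y - U x) 0) / T)

noncomputable def M2 {X : Type*} [Fintype X] [DecidableEq X] (Q : X → X → ℝ) (U : X → ℝ)
    (T : ℝ) (x y : X) : ℝ :=
  if x = y then -∑ z ∈ Finset.univ.erase x, Q x z * Real.exp (max (U x - U z) 0 / T)
  else Q x y * Real.exp (max (U x - U y) 0 / T)

def IsPath {X : Type*} (Q : X → X → ℝ) (x y : X) (n : ℕ) (γ : ℕ → X) : Prop :=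
  1 ≤ n ∧ γ 0 = x ∧ γ n = y ∧ ∀ i, 1 ≤ i → i ≤ n → 0 < Q (γ (i - 1)) (γ i)

noncomputable def Elev1 {X : Type*} (U : X → ℝ) (n : ℕ) (γ : ℕ → X) : ℝ :=
  sSup {r | ∃ i ≤ n, r = U (γ i)}

noncomputable def Elev2 {X : Type*} (U : X → ℝ) (n : ℕ) (γ : ℕ → X) : ℝ :=
  sSup {r | ∃ i, 1 ≤ i ∧ i ≤ n ∧ r = min (U (γ (i - 1))) (U (γ i))}

noncomputable def H1 {X : Type*} (Q : X → X → ℝ) (U : X → ℝ) (x y : X) : ℝ :=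
  sInf {r | ∃ n γ, IsPath Q x y n γ ∧ r = Elev1 U n γ}

noncomputable def H2 {X : Type*} (Q : X → X → ℝ) (U : X → ℝ) (x y : X) : ℝ :=
  sInf {r | ∃ n γ, IsPath Q x y n γ ∧ r = Elev2 U n γ}

noncomputable def cM1 {X : Type*} (Q : X → X → ℝ) (U : X → ℝ) : ℝ :=
  sSup {r | ∃ x y, x ≠ y ∧ r = H1 Q U x y - U x - U y}

noncomputable def cM2 {X : Type*} (Q : X → X → ℝ) (U : X → ℝ) : ℝ :=
  sSup {r | ∃ x y, x ≠ y ∧ r = H2 Q U x y - U x - U y}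

theorem finite_setOf_vertex_values {X : Type*} (U : X → ℝ) (n : ℕ) (γ : ℕ → X) :
    {r | ∃ i ≤ n, r = U (γ i)}.Finite :=
  ((Set.finite_Iic n).image fun i => U (γ i)).subset fun _ ⟨i, hi, hr⟩ => ⟨i, hi, hr.symm⟩

/-- The elevation `Elev1` of a path is the value of `U` at one of its vertices. -/
theorem elev1_mem_range {X : Type*} (U : X → ℝ) (n : ℕ) (γ : ℕ → X) :
    Elev1 U n γ ∈ Set.range U := by
  have hne : {r | ∃ i ≤ n, r = U (γ i)}.Nonempty := ⟨_, 0, Nat.zero_le n, rfl⟩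
  obtain ⟨i, -, hi⟩ := hne.csSup_mem (finite_setOf_vertex_values U n γ)
  exact ⟨γ i, hi.symm⟩

/-- Every vertex of a path lies below its elevation `Elev1`. -/
theorem le_elev1 {X : Type*} (U : X → ℝ) {n : ℕ} (γ : ℕ → X) {i : ℕ} (hi : i ≤ n) :
    U (γ i) ≤ Elev1 U n γ :=
  le_csSup (finite_setOf_vertex_values U n γ).bddAbove ⟨i, hi, rfl⟩

/-- The elevation `Elev2` of a nontrivial path is attained on one of its edges. -/
theorem exists_elev2_eq {X : Type*} (U : X → ℝ) {n : ℕ} (γ : ℕ → X) (hn : 1 ≤ n) :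
    ∃ i, 1 ≤ i ∧ i ≤ n ∧ Elev2 U n γ = min (U (γ (i - 1))) (U (γ i)) := by
  have hfin : {r | ∃ i, 1 ≤ i ∧ i ≤ n ∧ r = min (U (γ (i - 1))) (U (γ i))}.Finite :=
    ((Set.finite_Iic n).image fun i => min (U (γ (i - 1))) (U (γ i))).subset
      fun r ⟨i, _, hi, hr⟩ => ⟨i, hi, hr.symm⟩
  have hne : {r | ∃ i, 1 ≤ i ∧ i ≤ n ∧ r = min (U (γ (i - 1))) (U (γ i))}.Nonempty :=
    ⟨_, 1, le_rfl, hn, rfl⟩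
  exact hne.csSup_mem hfin

theorem elev2_mem_range {X : Type*} (U : X → ℝ) {n : ℕ} (γ : ℕ → X) (hn : 1 ≤ n) :
    Elev2 U n γ ∈ Set.range U := by
  obtain ⟨i, -, -, hi⟩ := exists_elev2_eq U γ hn
  rcases min_choice (U (γ (i - 1))) (U (γ i)) with h | h
  · exact ⟨_, (hi.trans h).symm⟩
  · exact ⟨_, (hi.trans h).symm⟩

theorem elev2_le_elev1 {X : Type*} (U : X → ℝ) {n : ℕ} (γ : ℕ → X) (hn : 1 ≤ n) :
    Elev2 U n γ ≤ Elev1 U n γ := by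
  obtain ⟨i, -, hin, hi⟩ := exists_elev2_eq U γ hn
  exact hi.trans_le ((min_le_right _ _).trans (le_elev1 U γ hin))

/-- If `U` is injective and `Q` has no loops, `Elev2` is strictly below `Elev1` on every path. -/
theorem elev2_lt_elev1 {X : Type*} {Q : X → X → ℝ} {U : X → ℝ} (hU : Function.Injective U)
    (hQ : ∀ x, Q x x ≤ 0) {x y : X} {n : ℕ} {γ : ℕ → X} (hγ : IsPath Q x y n γ) :
    Elev2 U n γ < Elev1 U n γ := by
  obtain ⟨i, h1i, hin, hi⟩ := exists_elev2_eq U γ hγ.1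
  have hne : γ (i - 1) ≠ γ i := fun h => by
    have hpos := hγ.2.2.2 i h1i hin
    rw [h] at hpos
    exact (hQ _).not_gt hpos
  rw [hi]
  exact (min_lt_max.2 (hU.ne hne)).trans_le
    (max_le (le_elev1 U γ (by omega)) (le_elev1 U γ hin))

/-- The minimum defining `H1` is attained. -/
theorem exists_h1_eq {X : Type*} [Finite X] {Q : X → X → ℝ} (U : X → ℝ) {x y : X}
    (h : ∃ n γ, IsPath Q x y n γ) : ∃ n γ, IsPath Q x y n γ ∧ H1 Q U x y = Elev1 U n γ := by
  have hfin : {r | ∃ n γ, IsPath Q x y n γ ∧ r = Elev1 U n γ}.Finite :=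
    (Set.finite_range U).subset fun r ⟨n, γ, _, hr⟩ => hr ▸ elev1_mem_range U n γ
  obtain ⟨n, γ, hγ⟩ := h
  have hne : {r | ∃ n γ, IsPath Q x y n γ ∧ r = Elev1 U n γ}.Nonempty := ⟨_, n, γ, hγ, rfl⟩
  exact hne.csInf_mem hfin

theorem h2_le_elev2 {X : Type*} [Finite X] {Q : X → X → ℝ} (U : X → ℝ) {x y : X} {n : ℕ}
    {γ : ℕ → X} (hγ : IsPath Q x y n γ) : H2 Q U x y ≤ Elev2 U n γ := by
  have hfin : {r | ∃ n γ, IsPath Q x y n γ ∧ r = Elev2 U n γ}.Finite :=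
    (Set.finite_range U).subset fun r ⟨n, γ, hγ, hr⟩ => hr ▸ elev2_mem_range U γ hγ.1
  exact csInf_le hfin.bddBelow ⟨n, γ, hγ, rfl⟩

theorem finite_setOf_pair_values {X : Type*} [Finite X] (f : X → X → ℝ) :
    {r | ∃ x y, x ≠ y ∧ r = f x y}.Finite :=
  (Set.finite_range fun p : X × X => f p.1 p.2).subset
    fun _ ⟨x, y, _, hr⟩ => ⟨(x, y), hr.symm⟩

/-- The maximum defining `cM2` is attained. -/
theorem exists_cM2_eq {X : Type*} [Finite X] [Nontrivial X] (Q : X → X → ℝ) (U : X → ℝ) :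
    ∃ x y, x ≠ y ∧ cM2 Q U = H2 Q U x y - U x - U y := by
  obtain ⟨x, y, hxy⟩ := exists_pair_ne X
  have hne : {r | ∃ x y, x ≠ y ∧ r = H2 Q U x y - U x - U y}.Nonempty := ⟨_, x, y, hxy, rfl⟩
  exact hne.csSup_mem
    (finite_setOf_pair_values fun x y => H2 Q U x y - U x - U y)

theorem le_cM1 {X : Type*} [Finite X] (Q : X → X → ℝ) (U : X → ℝ) {x y : X} (hxy : x ≠ y) :
    H1 Q U x y - U x - U y ≤ cM1 Q U :=
  le_csSup (finite_setOf_pair_values fun x y => H1 Q U x y - U x - U y).bddAbove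
    ⟨x, y, hxy, rfl⟩

theorem hill_climbing_constants_comparison
    {X : Type*} [Fintype X] [DecidableEq X] [Nontrivial X]
    (Q : X → X → ℝ) (U : X → ℝ)
    (hQnn : ∀ x y : X, x ≠ y → 0 ≤ Q x y)
    (hQdiag : ∀ x : X, Q x x = -∑ y ∈ Finset.univ.erase x, Q x y)
    (hirr : ∀ x y : X, x ≠ y → ∃ n γ, IsPath Q x y n γ) :
    cM2 Q U ≤ cM1 Q U ∧ (Function.Injective U → cM2 Q U < cM1 Q U) := by
  obtain ⟨x, y, hxy, hc⟩ := exists_cM2_eq Q U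
  obtain ⟨n, γ, hγ, hH⟩ := exists_h1_eq U (hirr x y hxy)
  have hH2 := h2_le_elev2 U hγ
  have hle := le_cM1 Q U hxy
  refine ⟨?_, fun hU => ?_⟩
  · have := elev2_le_elev1 U γ hγ.1
    linarith
  · have hQ : ∀ z, Q z z ≤ 0 := fun z => by
      rw [hQdiag z, neg_nonpos]
      exact Finset.sum_nonneg fun w hw => hQnn z w (Finset.ne_of_mem_erase hw).symm
    have := elev2_lt_elev1 hU hQ hγ
    linarith
end

section
/- (Spectral gap lower bound for M₂) Assume min_{x ∈ 𝒳} U(x) = 0. There exists a constant A > 0, depending only on 𝒳, Q, U and π but not on the temperature, such that for every T > 0 and every f : 𝒳 → ℝ with ∑_x f(x) π_T(x) = 0, one has ⟨−M_{2,T} f, f⟩_{π_T} ≥ A e^{−c_{M₂}/T} ⟨f, f⟩_{π_T}; in particular λ₂(−M_{2,T}) ≥ A e^{−c_{M₂}/T}. -/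
open Finset Filter MeasureTheory

/-- The conductance of the edge `(x, y)` for `M2`, up to the partition function. -/
noncomputable def conductance {X : Type*} (Q : X → X → ℝ) (p U : X → ℝ) (T : ℝ) (x y : X) : ℝ :=
  p x * Q x y * Real.exp (-min (U x) (U y) / T)

/-- The unnormalized Dirichlet energy of `f` for `M2`, summed over ordered pairs. -/
noncomputable def energy {X : Type*} [Fintype X] (Q : X → X → ℝ) (p U : X → ℝ) (T : ℝ)
    (f : X → ℝ) : ℝ :=
  ∑ x, ∑ y, conductance Q p U T x y * (f x - f y) ^ 2

/-- The partition function of the Gibbs distribution. -/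
noncomputable def partitionFn {X : Type*} [Fintype X] (p U : X → ℝ) (T : ℝ) : ℝ :=
  ∑ y, Real.exp (-U y / T) * p y

theorem partitionFn_pos {X : Type*} [Fintype X] [Nonempty X] {p : X → ℝ} (hp : ∀ x, 0 < p x)
    (U : X → ℝ) (T : ℝ) : 0 < partitionFn p U T :=
  Finset.sum_pos (fun y _ => mul_pos (Real.exp_pos _) (hp y)) Finset.univ_nonempty

theorem le_partitionFn {X : Type*} [Fintype X] {p U : X → ℝ} (hp : ∀ x, 0 < p x) (T : ℝ)
    {x : X} (hx : U x = 0) : p x ≤ partitionFn p U T := by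
  have h := Finset.single_le_sum (f := fun y => Real.exp (-U y / T) * p y)
    (fun y _ => (mul_pos (Real.exp_pos _) (hp y)).le) (Finset.mem_univ x)
  simpa [hx, partitionFn] using h

theorem gibbs_eq_div_partitionFn {X : Type*} [Fintype X] (p U : X → ℝ) (T : ℝ) (x : X) :
    gibbs p U T x = Real.exp (-U x / T) * p x / partitionFn p U T := rfl

theorem gibbs_pos {X : Type*} [Fintype X] [Nonempty X] {p : X → ℝ} (hp : ∀ x, 0 < p x)
    (U : X → ℝ) (T : ℝ) (x : X) : 0 < gibbs p U T x :=
  div_pos (mul_pos (Real.exp_pos _) (hp x)) (partitionFn_pos hp U T)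

theorem sum_gibbs {X : Type*} [Fintype X] [Nonempty X] {p : X → ℝ} (hp : ∀ x, 0 < p x)
    (U : X → ℝ) (T : ℝ) : ∑ x, gibbs p U T x = 1 := by
  simp only [gibbs_eq_div_partitionFn]
  rw [← Finset.sum_div]
  exact div_self (partitionFn_pos hp U T).ne'

theorem elev2_mem {X : Type*} (U : X → ℝ) {n : ℕ} (hn : 1 ≤ n) (γ : ℕ → X) :
    ∃ i, 1 ≤ i ∧ i ≤ n ∧ Elev2 U n γ = min (U (γ (i - 1))) (U (γ i)) := by
  have hfin : {r | ∃ i, 1 ≤ i ∧ i ≤ n ∧ r = min (U (γ (i - 1))) (U (γ i))}.Finite := by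
    refine ((Finset.Icc 1 n).finite_toSet.image
      fun i => min (U (γ (i - 1))) (U (γ i))).subset ?_
    rintro r ⟨i, h1, h2, rfl⟩
    exact ⟨i, by simp [h1, h2], rfl⟩
  have hne : {r | ∃ i, 1 ≤ i ∧ i ≤ n ∧ r = min (U (γ (i - 1))) (U (γ i))}.Nonempty :=
    ⟨_, 1, le_rfl, hn, rfl⟩
  exact hne.csSup_mem hfin

theorem min_le_elev2 {X : Type*} [Finite X] (U : X → ℝ) {n : ℕ} (γ : ℕ → X) {i : ℕ} (h1 : 1 ≤ i)
    (h2 : i ≤ n) : min (U (γ (i - 1))) (U (γ i)) ≤ Elev2 U n γ := by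
  refine le_csSup ?_ ⟨i, h1, h2, rfl⟩
  refine ((Set.finite_range fun z : X × X => min (U z.1) (U z.2)).subset ?_).bddAbove
  rintro r ⟨i, -, -, rfl⟩
  exact ⟨(_, _), rfl⟩

/-- The communication height `H2` is attained by a path. -/
theorem exists_path_elev2_eq_H2 {X : Type*} [Finite X] {Q : X → X → ℝ} (U : X → ℝ) {x y : X}
    (h : ∃ n γ, IsPath Q x y n γ) : ∃ n γ, IsPath Q x y n γ ∧ H2 Q U x y = Elev2 U n γ := by
  have hfin : {r | ∃ n γ, IsPath Q x y n γ ∧ r = Elev2 U n γ}.Finite := by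
    refine (Set.finite_range fun z : X × X => min (U z.1) (U z.2)).subset ?_
    rintro r ⟨n, γ, hγ, rfl⟩
    obtain ⟨i, -, -, hi⟩ := elev2_mem U hγ.1 γ
    exact ⟨(_, _), hi.symm⟩
  obtain ⟨n, γ, hγ⟩ := h
  have hne : {r | ∃ n γ, IsPath Q x y n γ ∧ r = Elev2 U n γ}.Nonempty := ⟨_, n, γ, hγ, rfl⟩
  exact hne.csInf_mem hfin

theorem H2_sub_sub_le_cM2 {X : Type*} [Finite X] (Q : X → X → ℝ) (U : X → ℝ) {x y : X}
    (h : x ≠ y) : H2 Q U x y - U x - U y ≤ cM2 Q U := by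
  refine le_csSup ?_ ⟨x, y, h, rfl⟩
  refine ((Set.finite_range fun z : X × X => H2 Q U z.1 z.2 - U z.1 - U z.2).subset ?_).bddAbove
  rintro r ⟨x, y, -, rfl⟩
  exact ⟨(x, y), rfl⟩

theorem conductance_mul_sq_le_energy {X : Type*} [Fintype X] {Q : X → X → ℝ} {p : X → ℝ}
    (hQ : ∀ x y, x ≠ y → 0 ≤ Q x y) (hp : ∀ x, 0 < p x) (U : X → ℝ) (T : ℝ) (f : X → ℝ)
    (a b : X) : conductance Q p U T a b * (f a - f b) ^ 2 ≤ energy Q p U T f := by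
  have hnn : ∀ x y, 0 ≤ conductance Q p U T x y * (f x - f y) ^ 2 := by
    intro x y
    rcases eq_or_ne x y with rfl | hxy
    · simp
    · have := hQ x y hxy
      have := hp x
      unfold conductance
      positivity
  calc _ ≤ ∑ y, conductance Q p U T a y * (f a - f y) ^ 2 :=
        Finset.single_le_sum (f := fun y => conductance Q p U T a y * (f a - f y) ^ 2)
          (fun y _ => hnn a y) (Finset.mem_univ b)
    _ ≤ _ := Finset.single_le_sum
          (f := fun x => ∑ y, conductance Q p U T x y * (f x - f y) ^ 2)
          (fun x _ => Finset.sum_nonneg fun y _ => hnn x y) (Finset.mem_univ a)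

theorem energy_nonneg {X : Type*} [Fintype X] [Nonempty X] {Q : X → X → ℝ} {p : X → ℝ}
    (hQ : ∀ x y, x ≠ y → 0 ≤ Q x y) (hp : ∀ x, 0 < p x) (U : X → ℝ) (T : ℝ) (f : X → ℝ) :
    0 ≤ energy Q p U T f := by
  obtain ⟨a⟩ := ‹Nonempty X›
  simpa using conductance_mul_sq_le_energy hQ hp U T f a a

/-- The squared difference of `f` between two states is controlled by the energy, through a path
realizing the communication height. -/
theorem exists_sq_sub_le_energy {X : Type*} [Fintype X] {Q : X → X → ℝ} {p : X → ℝ}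
    (hQ : ∀ x y, x ≠ y → 0 ≤ Q x y) (hp : ∀ x, 0 < p x) (U : X → ℝ) {x y : X}
    (h : ∃ n γ, IsPath Q x y n γ) :
    ∃ C : ℝ, 0 ≤ C ∧ ∀ T > (0 : ℝ), ∀ f : X → ℝ,
      (f x - f y) ^ 2 ≤ C * Real.exp (H2 Q U x y / T) * energy Q p U T f := by
  obtain ⟨n, γ, ⟨-, rfl, rfl, hpos⟩, hH⟩ := exists_path_elev2_eq_H2 U h
  have hw : ∀ i ∈ Finset.range n, 0 < p (γ i) * Q (γ i) (γ (i + 1)) := fun i hi =>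
    mul_pos (hp _) (hpos (i + 1) (by omega) (Finset.mem_range.1 hi))
  refine ⟨n * ∑ i ∈ Finset.range n, (p (γ i) * Q (γ i) (γ (i + 1)))⁻¹,
    mul_nonneg n.cast_nonneg (Finset.sum_nonneg fun i hi => (inv_pos.2 (hw i hi)).le), ?_⟩
  intro T hT f
  have hstep : ∀ i ∈ Finset.range n, (f (γ i) - f (γ (i + 1))) ^ 2 ≤
      (p (γ i) * Q (γ i) (γ (i + 1)))⁻¹ *
        (Real.exp (H2 Q U (γ 0) (γ n) / T) * energy Q p U T f) := by
    intro i hi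
    have hmin : min (U (γ i)) (U (γ (i + 1))) ≤ H2 Q U (γ 0) (γ n) :=
      hH ▸ min_le_elev2 U γ (i := i + 1) (by omega) (Finset.mem_range.1 hi)
    have hE := conductance_mul_sq_le_energy hQ hp U T f (γ i) (γ (i + 1))
    have hexp : 1 ≤ Real.exp (H2 Q U (γ 0) (γ n) / T) *
        Real.exp (-min (U (γ i)) (U (γ (i + 1))) / T) := by
      rw [← Real.exp_add, ← add_div]
      exact Real.one_le_exp (div_nonneg (by linarith) hT.le)
    have hwi := hw i hi
    rw [inv_mul_eq_div, le_div_iff₀' hwi]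
    refine le_trans ?_ (mul_le_mul_of_nonneg_left hE (Real.exp_pos _).le)
    unfold conductance
    calc _ ≤ p (γ i) * Q (γ i) (γ (i + 1)) * (f (γ i) - f (γ (i + 1))) ^ 2 *
          (Real.exp (H2 Q U (γ 0) (γ n) / T) *
            Real.exp (-min (U (γ i)) (U (γ (i + 1))) / T)) :=
          le_mul_of_one_le_right (mul_nonneg hwi.le (sq_nonneg _)) hexp
      _ = _ := by ring
  calc (f (γ 0) - f (γ n)) ^ 2
      = (∑ i ∈ Finset.range n, (f (γ i) - f (γ (i + 1)))) ^ 2 := by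
        rw [Finset.sum_range_sub' fun i => f (γ i)]
    _ ≤ n * ∑ i ∈ Finset.range n, (f (γ i) - f (γ (i + 1))) ^ 2 := by
        simpa using sq_sum_le_card_mul_sum_sq (s := Finset.range n)
          (f := fun i => f (γ i) - f (γ (i + 1)))
    _ ≤ n * ∑ i ∈ Finset.range n, (p (γ i) * Q (γ i) (γ (i + 1)))⁻¹ *
        (Real.exp (H2 Q U (γ 0) (γ n) / T) * energy Q p U T f) := by
        gcongr with i hi
        exact hstep i hi
    _ = _ := by
        rw [← Finset.sum_mul]
        ring

theorem neg_sum_M2_mul {X : Type*} [Fintype X] [DecidableEq X] (Q : X → X → ℝ) (U : X → ℝ)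
    (T : ℝ) (f : X → ℝ) (x : X) :
    -(∑ y, M2 Q U T x y * f y) =
      ∑ y, Q x y * Real.exp (max (U x - U y) 0 / T) * (f x - f y) := by
  rw [← Finset.add_sum_erase _ _ (Finset.mem_univ x),
    ← Finset.add_sum_erase _ (fun y => Q x y * _ * (f x - f y)) (Finset.mem_univ x)]
  have h : ∑ y ∈ Finset.univ.erase x, M2 Q U T x y * f y =
      ∑ y ∈ Finset.univ.erase x, Q x y * Real.exp (max (U x - U y) 0 / T) * f y :=
    Finset.sum_congr rfl fun y hy => by
      rw [M2, if_neg (Finset.ne_of_mem_erase hy).symm]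
  rw [h, M2, if_pos rfl]
  simp only [mul_sub, Finset.sum_sub_distrib, ← Finset.sum_mul]
  ring

/-- The quadratic form of `-M2` as a Dirichlet energy. -/
theorem sum_neg_M2_mul_gibbs {X : Type*} [Fintype X] [DecidableEq X] {Q : X → X → ℝ} {p : X → ℝ}
    (hrev : ∀ x y, p x * Q x y = p y * Q y x) (U : X → ℝ) (T : ℝ) (f : X → ℝ) :
    ∑ x, (-(∑ y, M2 Q U T x y * f y)) * f x * gibbs p U T x =
      energy Q p U T f / (2 * partitionFn p U T) := by
  have hs : ∀ x y, conductance Q p U T x y = conductance Q p U T y x := fun x y => by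
    rw [conductance, conductance, hrev, min_comm]
  have h1 : ∑ x, (-(∑ y, M2 Q U T x y * f y)) * f x * gibbs p U T x =
      (∑ x, ∑ y, conductance Q p U T x y * (f x - f y) * f x) / partitionFn p U T := by
    rw [Finset.sum_div]
    refine Finset.sum_congr rfl fun x _ => ?_
    rw [neg_sum_M2_mul, Finset.sum_mul, Finset.sum_mul, Finset.sum_div]
    refine Finset.sum_congr rfl fun y _ => ?_
    have hexp : Real.exp (-min (U x) (U y) / T) =
        Real.exp (max (U x - U y) 0 / T) * Real.exp (-U x / T) := by
      rw [← Real.exp_add, ← add_div]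
      congr 2
      rcases le_total (U x) (U y) with h | h
      · rw [min_eq_left h, max_eq_right (by linarith)]; ring
      · rw [min_eq_right h, max_eq_left (by linarith)]; ring
    rw [gibbs_eq_div_partitionFn, conductance, hexp]
    ring
  have h2 : ∑ x, ∑ y, conductance Q p U T x y * (f x - f y) * f x =
      ∑ x, ∑ y, conductance Q p U T x y * (f y - f x) * f y := by
    rw [Finset.sum_comm]
    exact Finset.sum_congr rfl fun x _ => Finset.sum_congr rfl fun y _ => by rw [hs y x]
  have h3 : energy Q p U T f =
      2 * ∑ x, ∑ y, conductance Q p U T x y * (f x - f y) * f x := by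
    rw [two_mul]
    conv_rhs => rw [h2]
    nth_rewrite 1 [← h2]
    simp only [energy, ← Finset.sum_add_distrib]
    exact Finset.sum_congr rfl fun x _ => Finset.sum_congr rfl fun y _ => by ring
  rw [h1, h3, mul_div_mul_left _ _ two_ne_zero]

/-- The second moment of a centred function as a double sum of squared differences. -/
theorem two_mul_sum_mul_self_eq {X : Type*} [Fintype X] {g f : X → ℝ} (hg : ∑ x, g x = 1)
    (hf : ∑ x, f x * g x = 0) :
    2 * ∑ x, f x * f x * g x = ∑ x, ∑ y, (f x - f y) ^ 2 * (g x * g y) := by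
  have h : ∀ x y, (f x - f y) ^ 2 * (g x * g y) =
      f x * f x * g x * g y + g x * (f y * f y * g y) - 2 * ((f x * g x) * (f y * g y)) :=
    fun x y => by ring
  simp only [h, Finset.sum_sub_distrib, Finset.sum_add_distrib, ← Finset.mul_sum,
    ← Finset.sum_mul, hg, hf]
  ring

/-- The Poincaré inequality for `M2`, with the exponential rate given by `cM2`. -/
theorem exists_poincare_M2 {X : Type*} [Fintype X] [DecidableEq X]
    {Q : X → X → ℝ} {p U : X → ℝ}
    (hQ : ∀ x y : X, x ≠ y → 0 ≤ Q x y)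
    (hirr : ∀ x y : X, x ≠ y → ∃ n γ, IsPath Q x y n γ)
    (hp : ∀ x, 0 < p x)
    (hrev : ∀ x y, p x * Q x y = p y * Q y x) (hU : ∃ x, U x = 0) :
    ∃ A > (0 : ℝ), ∀ T > (0 : ℝ), ∀ f : X → ℝ, (∑ x, f x * gibbs p U T x) = 0 →
      A * Real.exp (-(cM2 Q U) / T) * (∑ x, f x * f x * gibbs p U T x)
        ≤ ∑ x, (-(∑ y, M2 Q U T x y * f y)) * f x * gibbs p U T x := by
  obtain ⟨x₀, hx₀⟩ := hU
  have : Nonempty X := ⟨x₀⟩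
  have hC : ∀ x y, ∃ C : ℝ, 0 ≤ C ∧ (x ≠ y → ∀ T > (0 : ℝ), ∀ f : X → ℝ,
      (f x - f y) ^ 2 ≤ C * Real.exp (H2 Q U x y / T) * energy Q p U T f) := by
    intro x y
    by_cases hxy : x = y
    · exact ⟨0, le_rfl, fun h => absurd hxy h⟩
    · obtain ⟨C, hC0, hC⟩ := exists_sq_sub_le_energy hQ hp U (hirr x y hxy)
      exact ⟨C, hC0, fun _ => hC⟩
  choose C hC0 hC using hC
  set S : ℝ := ∑ x, ∑ y, C x y * (p x * p y) with hS
  have hS0 : 0 ≤ S := Finset.sum_nonneg fun x _ => Finset.sum_nonneg fun y _ =>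
    mul_nonneg (hC0 x y) (mul_pos (hp x) (hp y)).le
  refine ⟨p x₀ / (S + 1), div_pos (hp x₀) (by linarith), fun T hT f hf => ?_⟩
  have hZ := partitionFn_pos hp U T
  have hZ₀ := le_partitionFn hp T hx₀
  have hE := energy_nonneg hQ hp U T f
  have hterm : ∀ x y, (f x - f y) ^ 2 * (gibbs p U T x * gibbs p U T y) ≤
      C x y * (p x * p y) *
        (Real.exp (cM2 Q U / T) * energy Q p U T f / partitionFn p U T ^ 2) := by
    intro x y
    have hpp := mul_pos (hp x) (hp y)
    rcases eq_or_ne x y with rfl | hxy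
    · have := hC0 x x
      rw [sub_self, zero_pow two_ne_zero, zero_mul]
      positivity
    · have hexp : Real.exp (H2 Q U x y / T) * Real.exp (-U x / T) * Real.exp (-U y / T) ≤
          Real.exp (cM2 Q U / T) := by
        rw [← Real.exp_add, ← Real.exp_add, ← add_div, ← add_div]
        refine Real.exp_le_exp.2 (div_le_div_of_nonneg_right ?_ hT.le)
        linarith [H2_sub_sub_le_cM2 Q U hxy]
      calc _ ≤ C x y * Real.exp (H2 Q U x y / T) * energy Q p U T f *
            (gibbs p U T x * gibbs p U T y) :=
            mul_le_mul_of_nonneg_right (hC x y hxy T hT f)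
              (mul_pos (gibbs_pos hp U T x) (gibbs_pos hp U T y)).le
        _ = C x y * (p x * p y) * (energy Q p U T f / partitionFn p U T ^ 2) *
            (Real.exp (H2 Q U x y / T) * Real.exp (-U x / T) * Real.exp (-U y / T)) := by
            rw [gibbs_eq_div_partitionFn, gibbs_eq_div_partitionFn]
            field_simp
        _ ≤ C x y * (p x * p y) * (energy Q p U T f / partitionFn p U T ^ 2) *
            Real.exp (cM2 Q U / T) := by
            have := hC0 x y
            gcongr
        _ = _ := by ring
  have hvar : 2 * ∑ x, f x * f x * gibbs p U T x ≤
      S * (Real.exp (cM2 Q U / T) * energy Q p U T f / partitionFn p U T ^ 2) := by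
    rw [two_mul_sum_mul_self_eq (sum_gibbs hp U T) hf, hS, Finset.sum_mul]
    refine Finset.sum_le_sum fun x _ => ?_
    rw [Finset.sum_mul]
    exact Finset.sum_le_sum fun y _ => hterm x y
  rw [sum_neg_M2_mul_gibbs hrev]
  have hS1 : 0 < S + 1 := by linarith
  have hp₀ := hp x₀
  calc p x₀ / (S + 1) * Real.exp (-(cM2 Q U) / T) * (∑ x, f x * f x * gibbs p U T x)
      ≤ p x₀ / (S + 1) * Real.exp (-(cM2 Q U) / T) *
        (S * (Real.exp (cM2 Q U / T) * energy Q p U T f / partitionFn p U T ^ 2) / 2) := by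
        gcongr
        linarith
    _ = (p x₀ / partitionFn p U T) * (S / (S + 1)) *
        (energy Q p U T f / (2 * partitionFn p U T)) := by
        rw [neg_div, Real.exp_neg]
        field_simp
    _ ≤ 1 * 1 * (energy Q p U T f / (2 * partitionFn p U T)) := by
        gcongr
        · exact (div_le_one hZ).2 hZ₀
        · exact (div_le_one hS1).2 (by linarith)
    _ = _ := by ring

/-- On a space with two points, a positive weight admits a nonzero centred function. -/
theorem exists_ne_zero_sum_mul_eq_zero {X : Type*} [Fintype X] [DecidableEq X] [Nontrivial X]
    {g : X → ℝ} (hg : ∀ x, 0 < g x) : ∃ f : X → ℝ, f ≠ 0 ∧ ∑ x, f x * g x = 0 := by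
  obtain ⟨a, b, hab⟩ := exists_pair_ne X
  refine ⟨Pi.single a (g b) - Pi.single b (g a), fun h => ?_, ?_⟩
  · have := congrFun h a
    simp [hab, (hg b).ne'] at this
  · simp only [Pi.sub_apply, sub_mul, Pi.single_apply, ite_mul, zero_mul,
      Finset.sum_sub_distrib, Finset.sum_ite_eq', Finset.mem_univ, if_true]
    ring

theorem spectral_gap_lower_bound_M2
    {X : Type*} [Fintype X] [DecidableEq X] [Nontrivial X]
    (Q : X → X → ℝ) (p : X → ℝ) (U : X → ℝ)
    (hQnn : ∀ x y : X, x ≠ y → 0 ≤ Q x y)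
    (hQdiag : ∀ x : X, Q x x = -∑ y ∈ Finset.univ.erase x, Q x y)
    (hirr : ∀ x y : X, x ≠ y → ∃ n γ, IsPath Q x y n γ)
    (hppos : ∀ x, 0 < p x) (hpsum : ∑ x, p x = 1)
    (hrev : ∀ x y, p x * Q x y = p y * Q y x)
    (hUnn : ∀ x, 0 ≤ U x) (hUmin : ∃ x, U x = 0) :
    ∃ A > (0:ℝ), ∀ T > (0:ℝ),
      (∀ f : X → ℝ, (∑ x, f x * gibbs p U T x) = 0 →
        A * Real.exp (-(cM2 Q U) / T) * (∑ x, f x * f x * gibbs p U T x)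
          ≤ ∑ x, (-(∑ y, M2 Q U T x y * f y)) * f x * gibbs p U T x) ∧
      A * Real.exp (-(cM2 Q U) / T)
        ≤ sInf {r : ℝ | ∃ f : X → ℝ, f ≠ 0 ∧ (∑ x, f x * gibbs p U T x) = 0 ∧
            r = (∑ x, (-(∑ y, M2 Q U T x y * f y)) * f x * gibbs p U T x) /
                (∑ x, f x * f x * gibbs p U T x)} := by
  obtain ⟨A, hA, hgap⟩ := exists_poincare_M2 hQnn hirr hppos hrev hUmin
  refine ⟨A, hA, fun T hT => ⟨hgap T hT, ?_⟩⟩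
  have hg := gibbs_pos hppos U T
  refine le_csInf ?_ ?_
  · obtain ⟨f, hf0, hf⟩ := exists_ne_zero_sum_mul_eq_zero hg
    exact ⟨_, f, hf0, hf, rfl⟩
  · rintro r ⟨f, hf0, hf, rfl⟩
    obtain ⟨a, ha⟩ := Function.ne_iff.1 hf0
    have hpos : 0 < ∑ x, f x * f x * gibbs p U T x :=
      Finset.sum_pos' (fun x _ => mul_nonneg (mul_self_nonneg _) (hg x).le)
        ⟨a, Finset.mem_univ a, mul_pos (mul_self_pos.2 ha) (hg a)⟩
    exact (le_div_iff₀ hpos).2 (hgap T hT f hf)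
end

section
/- (X^{M₁} may get trapped under fast cooling) Assume δ := min{U(y) − U(x) : x a local minimum of U, y ≠ x with Q(x,y) > 0} > 0 (e.g. all local minima are strict). Fix ε with 0 < ε < δ and take the cooling schedule T(s) = (δ − ε)/log(s+1) for s > 0. Then for every local minimum x of U: ∑_{y ≠ x} M_{1,T(s)}(x,y) ≤ e^{−δ/T(s)} ∑_{y ≠ x} Q(x,y) = (s+1)^{−δ/(δ−ε)} ∑_{y ≠ x} Q(x,y) for all s > 0, the integral ∫₀^∞ ∑_{y ≠ x} M_{1,T(s)}(x,y) ds is finite, and hence lim_{t → ∞} exp(∫₀^t M_{1,T(s)}(x,x) ds) ≥ exp(−(∑_{y ≠ x} Q(x,y)) ∫₀^∞ (s+1)^{−δ/(δ−ε)} ds) > 0. -/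
open Finset Filter MeasureTheory

def IsLocMin {X : Type*} (Q : X → X → ℝ) (U : X → ℝ) (x : X) : Prop :=
  ∀ y, 0 < Q x y → U x ≤ U y

/-- The jump rates of `M1` out of `x` sum to minus its diagonal entry. -/
lemma M1_diag_eq_neg_sum {X : Type*} [Fintype X] [DecidableEq X] (Q : X → X → ℝ) (U : X → ℝ)
    (T : ℝ) (x : X) : M1 Q U T x x = -∑ y ∈ Finset.univ.erase x, M1 Q U T x y := by
  rw [M1, if_pos rfl]
  congr 1
  refine Finset.sum_congr rfl fun z hz => ?_
  rw [M1, if_neg (Finset.ne_of_mem_erase hz).symm]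

lemma M1_nonneg_of_ne {X : Type*} [Fintype X] [DecidableEq X] {Q : X → X → ℝ} (U : X → ℝ)
    (hQnn : ∀ x y : X, x ≠ y → 0 ≤ Q x y) (T : ℝ) {x y : X} (hxy : x ≠ y) :
    0 ≤ M1 Q U T x y := by
  rw [M1, if_neg hxy]
  exact mul_nonneg (hQnn x y hxy) (Real.exp_pos _).le

/-- If every allowed step out of `x` climbs at least `δ`, the total jump rate out of `x` is damped
by `exp (-δ / T)`. -/
lemma sum_M1_le_exp_mul_sum {X : Type*} [Fintype X] [DecidableEq X] {Q : X → X → ℝ} {U : X → ℝ}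
    (hQnn : ∀ x y : X, x ≠ y → 0 ≤ Q x y) {δ T : ℝ} (hT : 0 ≤ T) {x : X}
    (hx : ∀ y, y ≠ x → 0 < Q x y → δ ≤ U y - U x) :
    ∑ y ∈ Finset.univ.erase x, M1 Q U T x y
      ≤ Real.exp (-δ / T) * ∑ y ∈ Finset.univ.erase x, Q x y := by
  rw [Finset.mul_sum]
  refine Finset.sum_le_sum fun y hy => ?_
  have hyx := Finset.ne_of_mem_erase hy
  rw [M1, if_neg hyx.symm, mul_comm]
  rcases (hQnn x y hyx.symm).eq_or_lt with h | h
  · simp [← h]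
  · gcongr
    exact (hx y hyx h).trans (le_max_left _ _)

lemma measurable_M1 {X : Type*} [Fintype X] [DecidableEq X] (Q : X → X → ℝ) (U : X → ℝ)
    (x y : X) : Measurable fun T => M1 Q U T x y := by
  unfold M1
  split_ifs <;> fun_prop

lemma sInf_localMin_gap_le {X : Type*} {Q : X → X → ℝ} {U : X → ℝ} {x y : X}
    (hx : IsLocMin Q U x) (hyx : y ≠ x) (hxy : 0 < Q x y) :
    sInf {r : ℝ | ∃ x y : X, IsLocMin Q U x ∧ y ≠ x ∧ 0 < Q x y ∧ r = U y - U x} ≤ U y - U x := by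
  refine csInf_le ⟨0, ?_⟩ ⟨x, y, hx, hyx, hxy, rfl⟩
  rintro r ⟨a, b, ha, -, hab, rfl⟩
  exact sub_nonneg.2 (ha b hab)

theorem M1_trapped_under_fast_cooling
    {X : Type*} [Fintype X] [DecidableEq X] [Nontrivial X]
    (Q : X → X → ℝ) (U : X → ℝ)
    (hQnn : ∀ x y : X, x ≠ y → 0 ≤ Q x y)
    (hQdiag : ∀ x : X, Q x x = -∑ y ∈ Finset.univ.erase x, Q x y)
    (δ : ℝ)
    (hδdef : δ = sInf {r : ℝ | ∃ x y : X, IsLocMin Q U x ∧ y ≠ x ∧ 0 < Q x y ∧ r = U y - U x})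
    (hδ : 0 < δ) (ε : ℝ) (hε : 0 < ε) (hεδ : ε < δ)
    (T : ℝ → ℝ) (hT : ∀ s, T s = (δ - ε) / Real.log (s + 1)) :
    ∀ x : X, IsLocMin Q U x →
      (∀ s > (0:ℝ),
        (∑ y ∈ Finset.univ.erase x, M1 Q U (T s) x y
          ≤ Real.exp (-δ / T s) * ∑ y ∈ Finset.univ.erase x, Q x y) ∧
        Real.exp (-δ / T s) * ∑ y ∈ Finset.univ.erase x, Q x y
          = (s + 1) ^ (-(δ / (δ - ε))) * ∑ y ∈ Finset.univ.erase x, Q x y) ∧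
      MeasureTheory.IntegrableOn
        (fun s => ∑ y ∈ Finset.univ.erase x, M1 Q U (T s) x y) (Set.Ioi 0) ∧
      ∃ L : ℝ,
        Filter.Tendsto (fun t => Real.exp (∫ s in (0:ℝ)..t, M1 Q U (T s) x x))
          Filter.atTop (nhds L) ∧
        Real.exp (-(∑ y ∈ Finset.univ.erase x, Q x y) *
            ∫ s in Set.Ioi (0:ℝ), (s + 1) ^ (-(δ / (δ - ε)))) ≤ L ∧
        0 < L := by
  intro x hx
  have hδε : 0 < δ - ε := sub_pos.2 hεδ
  have hexp (s : ℝ) (hs : 0 < s) :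
      Real.exp (-δ / T s) = (s + 1) ^ (-(δ / (δ - ε))) := by
    rw [Real.rpow_def_of_pos (by linarith), hT, div_div_eq_mul_div]
    congr 1
    ring
  have hTnn (s : ℝ) (hs : 0 < s) : 0 ≤ T s := by
    rw [hT]
    exact div_nonneg hδε.le (Real.log_nonneg (by linarith))
  have hle (s : ℝ) (hs : 0 < s) : ∑ y ∈ Finset.univ.erase x, M1 Q U (T s) x y
      ≤ Real.exp (-δ / T s) * ∑ y ∈ Finset.univ.erase x, Q x y :=
    sum_M1_le_exp_mul_sum hQnn (hTnn s hs) fun y hyx hxy =>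
      hδdef.trans_le (sInf_localMin_gap_le hx hyx hxy)
  have hTmeas : Measurable T := by
    rw [funext hT]
    fun_prop
  have hbound : IntegrableOn
      (fun s : ℝ => (s + 1) ^ (-(δ / (δ - ε))) * ∑ y ∈ Finset.univ.erase x, Q x y)
      (Set.Ioi 0) := by
    refine Integrable.mul_const (integrableOn_add_rpow_Ioi_of_lt ?_ (by norm_num)) _
    rw [neg_lt_neg_iff, one_lt_div hδε]
    linarith
  have hint : IntegrableOn
      (fun s => ∑ y ∈ Finset.univ.erase x, M1 Q U (T s) x y) (Set.Ioi 0) := by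
    refine Integrable.mono' hbound ?_ ?_
    · exact (Finset.measurable_fun_sum _ fun y _ =>
        (measurable_M1 Q U x y).comp hTmeas).aestronglyMeasurable
    · refine (ae_restrict_iff' measurableSet_Ioi).2 (ae_of_all _ fun s hs => ?_)
      rw [Real.norm_of_nonneg (Finset.sum_nonneg fun y hy =>
        M1_nonneg_of_ne U hQnn _ (Finset.ne_of_mem_erase hy).symm), ← hexp s hs]
      exact hle s hs
  refine ⟨fun s hs => ⟨hle s hs, by rw [hexp s hs]⟩, hint,
    Real.exp (-∫ s in Set.Ioi (0:ℝ), ∑ y ∈ Finset.univ.erase x, M1 Q U (T s) x y),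
    ?_, ?_, Real.exp_pos _⟩
  · simp only [M1_diag_eq_neg_sum, intervalIntegral.integral_neg]
    exact (Real.continuous_exp.tendsto _).comp
      (intervalIntegral_tendsto_integral_Ioi 0 hint tendsto_id).neg
  · rw [Real.exp_le_exp, neg_mul, neg_le_neg_iff, mul_comm, ← integral_mul_const]
    refine setIntegral_mono_on hint hbound measurableSet_Ioi fun s hs => ?_
    rw [← hexp s hs]
    exact hle s hs
end

section
/- (Uniformized transition probabilities of M₂ dominate those of M₁ along shortest paths) Let x ≠ y in 𝒳 and let k ≥ 1 be the minimal n for which there exists a sequence x = γ₀, γ₁, …, γₙ = y with Q(γ_{i−1}, γ_i) > 0 for all i. Let T₁, …, T_k > 0, let R = max_z U(z) − min_z U(z), and let M > 0 satisfy M ≥ e^{R/T_j} max_{z ∈ 𝒳} |Q(z,z)| for every 1 ≤ j ≤ k. Define, for i = 1, 2 and 1 ≤ j ≤ k, the stochastic matrices 𝒫^{(i)}_j(u,v) = 1_{u=v} + M_{i,T_j}(u,v)/M. Then the matrix product satisfies (𝒫^{(2)}_1 𝒫^{(2)}_2 ⋯ 𝒫^{(2)}_k)(x,y) ≥ (𝒫^{(1)}_1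 𝒫^{(1)}_2 ⋯ 𝒫^{(1)}_k)(x,y). -/
open Finset Filter MeasureTheory

/-- `v` is reached from `x` in exactly `n` steps of the relation `E`. -/
def StepsTo {X : Type*} (E : X → X → Prop) (x : X) : ℕ → X → Prop
  | 0, v => x = v
  | n + 1, v => ∃ w, StepsTo E x n w ∧ E w v

theorem StepsTo.exists_seq {X : Type*} {E : X → X → Prop} {x : X} {n : ℕ} {v : X}
    (h : StepsTo E x n v) :
    ∃ γ : ℕ → X, γ 0 = x ∧ γ n = v ∧ ∀ i < n, E (γ i) (γ (i + 1)) := by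
  induction n generalizing v with
  | zero => exact ⟨fun _ => x, rfl, h, by simp⟩
  | succ n ih =>
    obtain ⟨w, hw, hE⟩ := h
    obtain ⟨γ, h0, hn, hstep⟩ := ih hw
    refine ⟨Function.update γ (n + 1) v, by simp [h0], by simp, fun i hi => ?_⟩
    rw [Function.update_of_ne (by omega)]
    rcases Nat.lt_succ_iff_lt_or_eq.mp hi with hlt | rfl
    · rw [Function.update_of_ne (by omega)]
      exact hstep i hlt
    · simpa [hn] using hE

theorem StepsTo.exists_isPath {X : Type*} {Q : X → X → ℝ} {x y : X} {n : ℕ}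
    (h : StepsTo (fun u v => 0 < Q u v) x n y) (hn : 1 ≤ n) : ∃ γ, IsPath Q x y n γ := by
  obtain ⟨γ, h0, hy, hstep⟩ := h.exists_seq
  refine ⟨γ, hn, h0, hy, fun i hi hin => ?_⟩
  simpa [Nat.sub_add_cancel hi] using hstep (i - 1) (by omega)

theorem not_stepsTo_of_edge {X : Type*} {E : X → X → Prop} {x v w : X} {n : ℕ}
    (hfar : ∀ m < n + 1, ¬ StepsTo E x m v) (hE : E w v) : ∀ m < n, ¬ StepsTo E x m w :=
  fun m hm h => hfar (m + 1) (by omega) ⟨w, h, hE⟩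

/-- A product of `n` matrices supported on the diagonal and the edges of `E` vanishes at `(x, v)`
when `v` is at distance more than `n` from `x`. -/
theorem prod_apply_eq_zero_of_not_stepsTo {X : Type*} [Fintype X] [DecidableEq X]
    {E : X → X → Prop} {A : ℕ → Matrix X X ℝ} {x : X}
    (hA : ∀ j u v, u ≠ v → ¬ E u v → A j u v = 0) (n : ℕ) (v : X)
    (hfar : ∀ m < n + 1, ¬ StepsTo E x m v) : ((List.range n).map A).prod x v = 0 := by
  induction n generalizing v with
  | zero => simpa using Matrix.one_apply_ne (hfar 0 (by omega))
  | succ n ih =>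
    rw [List.range_succ, List.map_append, List.prod_append, Matrix.mul_apply]
    refine Finset.sum_eq_zero fun w _ => ?_
    simp only [List.map_cons, List.map_nil, List.prod_singleton]
    by_cases hwv : w = v
    · subst hwv
      rw [ih w fun m hm => hfar m (by omega), zero_mul]
    by_cases hE : E w v
    · rw [ih w (not_stepsTo_of_edge hfar hE), zero_mul]
    · rw [hA n w v hwv hE, mul_zero]

/-- Off-diagonal domination of nonnegative entries passes to products of `n` matrices, at pairs
of points at distance at least `n`: the diagonal entries do not contribute there. -/
theorem prod_apply_nonneg_and_le_of_not_stepsTo {X : Type*} [Fintype X] [DecidableEq X]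
    {E : X → X → Prop} {A B : ℕ → Matrix X X ℝ} {x : X}
    (hA : ∀ j u v, u ≠ v → ¬ E u v → A j u v = 0)
    (hB : ∀ j u v, u ≠ v → ¬ E u v → B j u v = 0) (n : ℕ)
    (hAnn : ∀ j < n, ∀ u v, u ≠ v → 0 ≤ A j u v)
    (hAB : ∀ j < n, ∀ u v, u ≠ v → A j u v ≤ B j u v) (v : X)
    (hfar : ∀ m < n, ¬ StepsTo E x m v) :
    0 ≤ ((List.range n).map A).prod x v ∧
      ((List.range n).map A).prod x v ≤ ((List.range n).map B).prod x v := by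
  induction n generalizing v with
  | zero => by_cases h : x = v <;> simp [h]
  | succ n ih =>
    simp only [List.range_succ, List.map_append, List.prod_append, Matrix.mul_apply,
      List.map_cons, List.map_nil, List.prod_singleton]
    have key : ∀ w, 0 ≤ ((List.range n).map A).prod x w * A n w v ∧
        ((List.range n).map A).prod x w * A n w v ≤
          ((List.range n).map B).prod x w * B n w v := by
      intro w
      by_cases hwv : w = v
      · subst hwv
        simp [prod_apply_eq_zero_of_not_stepsTo hA n w hfar,
          prod_apply_eq_zero_of_not_stepsTo hB n w hfar]
      by_cases hE : E w v
      · obtain ⟨h0, hle⟩ := ih (fun j hj => hAnn j (by omega)) (fun j hj => hAB j (by omega)) w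
          (not_stepsTo_of_edge hfar hE)
        have hA0 := hAnn n (by omega) w v hwv
        exact ⟨mul_nonneg h0 hA0,
          mul_le_mul hle (hAB n (by omega) w v hwv) hA0 (h0.trans hle)⟩
      · simp [hA n w v hwv hE, hB n w v hwv hE]
    exact ⟨Finset.sum_nonneg fun w _ => (key w).1, Finset.sum_le_sum fun w _ => (key w).2⟩

theorem uniformized_M2_dominates_M1_along_shortest_paths
    {X : Type*} [Fintype X] [DecidableEq X] [Nontrivial X]
    (Q : X → X → ℝ) (U : X → ℝ)
    (hQnn : ∀ x y : X, x ≠ y → 0 ≤ Q x y)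
    (hQdiag : ∀ x : X, Q x x = -∑ y ∈ Finset.univ.erase x, Q x y)
    (hirr : ∀ x y : X, x ≠ y → ∃ n γ, IsPath Q x y n γ)
    (x y : X) (hxy : x ≠ y) (k : ℕ)
    (hpath : ∃ γ : ℕ → X, IsPath Q x y k γ)
    (hmink : ∀ (m : ℕ) (γ : ℕ → X), IsPath Q x y m γ → k ≤ m)
    (T : ℕ → ℝ) (hT : ∀ j < k, 0 < T j)
    (M : ℝ) (hM : 0 < M)
    (hMge : ∀ j < k,
      Real.exp ((Finset.univ.sup' Finset.univ_nonempty U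
            - Finset.univ.inf' Finset.univ_nonempty U) / T j) *
        Finset.univ.sup' Finset.univ_nonempty (fun z => |Q z z|) ≤ M) :
    (((List.range k).map (fun j => Matrix.of
        (fun u v : X => (if u = v then (1:ℝ) else 0) + M1 Q U (T j) u v / M))).prod x y)
    ≤ (((List.range k).map (fun j => Matrix.of
        (fun u v : X => (if u = v then (1:ℝ) else 0) + M2 Q U (T j) u v / M))).prod x y) := by
  have hQ0 : ∀ u v, u ≠ v → ¬ 0 < Q u v → Q u v = 0 := fun u v huv h =>
    le_antisymm (not_lt.mp h) (hQnn u v huv)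
  refine (prod_apply_nonneg_and_le_of_not_stepsTo (E := fun u v => 0 < Q u v)
    ?_ ?_ k ?_ ?_ y ?_).2
  · intro j u v huv h
    simp [M1, huv, hQ0 u v huv h]
  · intro j u v huv h
    simp [M2, huv, hQ0 u v huv h]
  · intro j _ u v huv
    have := hQnn u v huv
    simp only [Matrix.of_apply, M1, if_neg huv, zero_add]
    positivity
  · intro j hj u v huv
    have hTj := hT j hj
    have := hQnn u v huv
    simp only [Matrix.of_apply, M1, M2, if_neg huv, zero_add]
    gcongr
    have h1 := le_max_right (U v - U u) 0
    have h2 := le_max_right (U u - U v) 0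
    linarith
  · intro m hm h
    rcases Nat.eq_zero_or_pos m with rfl | hpos
    · exact hxy h
    · obtain ⟨γ, hγ⟩ := h.exists_isPath hpos
      exact absurd (hmink m γ hγ) (by omega)
end
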